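/- arXiv:2402.12257 — 8 statements merged into one kernel-verified Lean document; each statement's English description precedes it below -/
import Mathlib

section
/- Let P be a Markov operator on L¹(X,m), let w ∈ L¹(X,m) satisfy w > 0 a.e., and let C = {x ∈ X : Σ_{k=0}^∞ (Pᵏw)(x) = ∞} and D = X \ C. Then for every u ∈ L¹(X,m) with u ≥ 0 a.e., for m-almost every x ∈ C the sum Σ_{k=0}^∞ (Pᵏu)(x) is either 0 or ∞, and for m-almost every x ∈ D the sum Σ_{k=0}^∞ (Pᵏu)(x) is finite. -/
open MeasureTheory Filter Topology ENNReal

/-- A Markov operator on `L¹(X,m)`, represented by a linear operator on (representatives of)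
functions: it maps integrable functions to integrable functions, is positive
(`f ≥ 0` a.e. implies `P f ≥ 0` a.e.) and is an `L¹`-contraction. -/
def IsMarkovOperator {X : Type*} [MeasurableSpace X] (m : Measure X)
    (P : (X → ℝ) →ₗ[ℝ] (X → ℝ)) : Prop :=
  (∀ f : X → ℝ, Integrable f m → Integrable (P f) m) ∧
  (∀ f : X → ℝ, Integrable f m → 0 ≤ᵐ[m] f → 0 ≤ᵐ[m] P f) ∧
  (∀ f : X → ℝ, Integrable f m → ∫ x, |P f x| ∂m ≤ ∫ x, |f x| ∂m)

/-- The conservative part of `X` for the Markov operator `P`, determined by a strictly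
positive integrable function `w`: the set of points where `∑_{k=0}^∞ (Pᵏ w)(x) = ∞`. -/
def conservativePart {X : Type*} [MeasurableSpace X]
    (P : (X → ℝ) →ₗ[ℝ] (X → ℝ)) (w : X → ℝ) : Set X :=
  {x : X | (∑' k : ℕ, ENNReal.ofReal ((P ^ k) w x)) = ⊤}

/-- The truncated maximal functions of Garsia's proof of the maximal ergodic inequality. -/
noncomputable def garsiaMax {X : Type*} (P : (X → ℝ) →ₗ[ℝ] (X → ℝ)) (h : X → ℝ) : ℕ → X → ℝ
  | 0 => 0
  | n + 1 => garsiaMax P h n ⊔ (h + P (garsiaMax P h n))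

lemma garsiaMax_monotone {X : Type*} (P : (X → ℝ) →ₗ[ℝ] (X → ℝ)) (h : X → ℝ) :
    Monotone (garsiaMax P h) :=
  monotone_nat_of_le_succ fun _ => le_sup_left

namespace IsMarkovOperator

variable {X : Type*} [MeasurableSpace X] {m : Measure X} {P : (X → ℝ) →ₗ[ℝ] (X → ℝ)}
  {f g h : X → ℝ}

lemma mono (hP : IsMarkovOperator m P) (hf : Integrable f m) (hg : Integrable g m)
    (hfg : f ≤ᵐ[m] g) : P f ≤ᵐ[m] P g := by
  have key := hP.2.1 (g - f) (hg.sub hf) (by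
    filter_upwards [hfg] with x hx
    simpa using hx)
  filter_upwards [key] with x hx
  simpa [map_sub] using hx

lemma integrable_pow (hP : IsMarkovOperator m P) (hf : Integrable f m) (k : ℕ) :
    Integrable ((P ^ k) f) m := by
  induction k with
  | zero => simpa using hf
  | succ k ih => simpa [pow_succ'] using hP.1 _ ih

lemma pow_nonneg (hP : IsMarkovOperator m P) (hf : Integrable f m) (hf0 : 0 ≤ᵐ[m] f) (k : ℕ) :
    0 ≤ᵐ[m] (P ^ k) f := by
  induction k with
  | zero => simpa using hf0
  | succ k ih => simpa [pow_succ'] using hP.2.1 _ (hP.integrable_pow hf k) ih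

lemma integral_le (hP : IsMarkovOperator m P) (hf : Integrable f m) (hf0 : 0 ≤ᵐ[m] f) :
    ∫ x, P f x ∂m ≤ ∫ x, f x ∂m := by
  have key := hP.2.2 f hf
  have hPabs : (fun x => |P f x|) =ᵐ[m] P f := (hP.2.1 f hf hf0).mono fun x hx => abs_of_nonneg hx
  have habs : (fun x => |f x|) =ᵐ[m] f := hf0.mono fun x hx => abs_of_nonneg hx
  rwa [integral_congr_ae hPabs, integral_congr_ae habs] at key

lemma integrable_garsiaMax (hP : IsMarkovOperator m P) (hh : Integrable h m) (n : ℕ) :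
    Integrable (garsiaMax P h n) m := by
  induction n with
  | zero => exact integrable_zero _ _ _
  | succ n ih => exact ih.sup (hh.add (hP.1 _ ih))

lemma sum_pow_le_garsiaMax (hP : IsMarkovOperator m P) (hh : Integrable h m) (n : ℕ) :
    (∑ k ∈ Finset.range n, (P ^ k) h) ≤ᵐ[m] garsiaMax P h n := by
  induction n with
  | zero => exact EventuallyLE.refl _ _
  | succ n ih =>
    have key := hP.mono (integrable_finsetSum' _ fun k _ => hP.integrable_pow hh k)
      (hP.integrable_garsiaMax hh n) ih
    have hsum : (∑ k ∈ Finset.range (n + 1), (P ^ k) h)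
        = h + P (∑ k ∈ Finset.range n, (P ^ k) h) := by
      simp [Finset.sum_range_succ', map_sum, pow_succ', add_comm]
    rw [hsum]
    filter_upwards [key] with x hx
    exact le_sup_of_le_right (by simpa using hx)

lemma garsiaMax_le_add (hP : IsMarkovOperator m P) (hh : Integrable h m) (n : ℕ) :
    ∀ᵐ x ∂m, 0 < garsiaMax P h n x → garsiaMax P h n x ≤ h x + P (garsiaMax P h n) x := by
  induction n with
  | zero => simp [garsiaMax]
  | succ n ih =>
    have key := hP.mono (hP.integrable_garsiaMax hh n) (hP.integrable_garsiaMax hh (n + 1))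
      (Eventually.of_forall (garsiaMax_monotone P h n.le_succ))
    filter_upwards [ih, key] with x hx hk hpos
    rcases max_choice (garsiaMax P h n x) ((h + P (garsiaMax P h n)) x) with hc | hc
    · have hc' : garsiaMax P h (n + 1) x = garsiaMax P h n x := hc
      rw [hc'] at hpos ⊢
      linarith [hx hpos]
    · have hc' : garsiaMax P h (n + 1) x = h x + P (garsiaMax P h n) x := hc
      linarith

/-- The **Hopf maximal ergodic inequality**. -/
lemma setIntegral_garsiaMax_pos_nonneg (hP : IsMarkovOperator m P) (hh : Integrable h m) (n : ℕ) :
    0 ≤ ∫ x in {x | 0 < garsiaMax P h n x}, h x ∂m := by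
  set M := garsiaMax P h n
  have hM : Integrable M m := hP.integrable_garsiaMax hh n
  have hM0 : 0 ≤ M := garsiaMax_monotone P h n.zero_le
  have hE : NullMeasurableSet {x | 0 < M x} m :=
    nullMeasurableSet_lt aemeasurable_const hM.aemeasurable
  rw [← integral_indicator₀ hE]
  have hle : ∫ x, (M x - P M x) ∂m ≤ ∫ x, {x | 0 < M x}.indicator h x ∂m := by
    refine integral_mono_ae (hM.sub (hP.1 _ hM)) (hh.indicator₀ hE) ?_
    filter_upwards [hP.garsiaMax_le_add hh n, hP.2.1 M hM (Eventually.of_forall hM0)]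
      with x hx hPx
    have hPx' : 0 ≤ P M x := hPx
    by_cases hpos : 0 < M x
    · rw [Set.indicator_of_mem (show x ∈ {x | 0 < M x} from hpos)]
      linarith [hx hpos]
    · rw [Set.indicator_of_notMem (show x ∉ {x | 0 < M x} from hpos)]
      linarith
  rw [integral_sub hM (hP.1 _ hM)] at hle
  linarith [hP.integral_le hM (Eventually.of_forall hM0)]

lemma aemeasurable_tsum_pow (hP : IsMarkovOperator m P) (hf : Integrable f m) :
    AEMeasurable (fun x => ∑' k : ℕ, ENNReal.ofReal ((P ^ k) f x)) m :=
  AEMeasurable.tsum fun k => (hP.integrable_pow hf k).aemeasurable.ennreal_ofReal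

lemma mul_setLIntegral_garsiaMax_pos_le (hP : IsMarkovOperator m P) (hf : Integrable f m)
    (hf0 : 0 ≤ᵐ[m] f) (hg : Integrable g m) (hg0 : 0 ≤ᵐ[m] g) {a : ℝ} (ha : 0 ≤ a) (n : ℕ) :
    ENNReal.ofReal a * ∫⁻ x in {x | 0 < garsiaMax P (f - a • g) n x}, ENNReal.ofReal (g x) ∂m
      ≤ ∫⁻ x, ENNReal.ofReal (f x) ∂m := by
  have key := hP.setIntegral_garsiaMax_pos_nonneg (hf.sub (hg.smul a)) n
  set E := {x | 0 < garsiaMax P (f - a • g) n x}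
  have hsplit : ∫ x in E, (f - a • g) x ∂m = ∫ x in E, f x ∂m - a * ∫ x in E, g x ∂m := by
    rw [← integral_const_mul]
    exact integral_sub hf.integrableOn (hg.integrableOn.const_mul a)
  rw [← ofReal_integral_eq_lintegral_ofReal hf hf0,
    ← ofReal_integral_eq_lintegral_ofReal hg.integrableOn (ae_restrict_of_ae hg0),
    ← ENNReal.ofReal_mul ha]
  apply ENNReal.ofReal_le_ofReal
  linarith [setIntegral_le_integral (s := E) hf hf0]

lemma exists_garsiaMax_pos (hP : IsMarkovOperator m P) (hf : Integrable f m) (hf0 : 0 ≤ᵐ[m] f)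
    (hg : Integrable g m) (hg0 : 0 ≤ᵐ[m] g) {a : ℝ} (ha : 0 ≤ a) :
    ∀ᵐ x ∂m, (∑' k : ℕ, ENNReal.ofReal ((P ^ k) f x)) = ⊤ →
      (∑' k : ℕ, ENNReal.ofReal ((P ^ k) g x)) < ⊤ →
      ∃ n, 0 < garsiaMax P (f - a • g) n x := by
  filter_upwards [ae_all_iff.2 (hP.pow_nonneg hf hf0), ae_all_iff.2 (hP.pow_nonneg hg hg0),
    ae_all_iff.2 (hP.sum_pow_le_garsiaMax (hf.sub (hg.smul a)))] with x hfx hgx hS hftop hgfin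
  set G := ∑' k : ℕ, ENNReal.ofReal ((P ^ k) g x)
  have htend : Tendsto (fun n => ∑ k ∈ Finset.range n, ENNReal.ofReal ((P ^ k) f x)) atTop
      (𝓝 ⊤) := hftop ▸ ENNReal.tendsto_nat_tsum _
  obtain ⟨n, hn⟩ := (htend.eventually_const_lt
    (ENNReal.mul_lt_top ENNReal.ofReal_lt_top hgfin : ENNReal.ofReal a * G < ⊤)).exists
  refine ⟨n, lt_of_lt_of_le ?_ (hS n)⟩
  have hlt := (mul_le_mul_right (ENNReal.sum_le_tsum (Finset.range n))
    (ENNReal.ofReal a)).trans_lt hn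
  rw [← ENNReal.ofReal_sum_of_nonneg fun k _ => hfx k,
    ← ENNReal.ofReal_sum_of_nonneg fun k _ => hgx k, ← ENNReal.ofReal_mul ha] at hlt
  have hlt' := (ENNReal.ofReal_lt_ofReal_iff'.1 hlt).1
  simpa [Finset.sum_apply, map_sub, Finset.sum_sub_distrib, Finset.mul_sum] using hlt'

/-- A nonnegative `g` vanishes where its orbit sum is finite but some other nonnegative integrable
function has infinite orbit sum. -/
theorem ae_eq_zero_of_tsum_pow_lt_top (hP : IsMarkovOperator m P) (hf : Integrable f m)
    (hf0 : 0 ≤ᵐ[m] f) (hg : Integrable g m) (hg0 : 0 ≤ᵐ[m] g) :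
    ∀ᵐ x ∂m, (∑' k : ℕ, ENNReal.ofReal ((P ^ k) f x)) = ⊤ →
      (∑' k : ℕ, ENNReal.ofReal ((P ^ k) g x)) < ⊤ → g x = 0 := by
  set A := {x | (∑' k : ℕ, ENNReal.ofReal ((P ^ k) f x)) = ⊤ ∧
    (∑' k : ℕ, ENNReal.ofReal ((P ^ k) g x)) < ⊤}
  have hA : NullMeasurableSet A m :=
    ((hP.aemeasurable_tsum_pow hf).nullMeasurable (measurableSet_singleton ⊤)).inter
      ((hP.aemeasurable_tsum_pow hg).nullMeasurable measurableSet_Iio)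
  have hbound (a : ℕ) :
      (a : ℝ≥0∞) * ∫⁻ x in A, ENNReal.ofReal (g x) ∂m ≤ ∫⁻ x, ENNReal.ofReal (f x) ∂m := by
    have hsub : A ≤ᵐ[m] ⋃ n, {x | 0 < garsiaMax P (f - (a : ℝ) • g) n x} := by
      filter_upwards [hP.exists_garsiaMax_pos hf hf0 hg hg0 a.cast_nonneg] with x hx hxA
      exact Set.mem_iUnion.2 (hx hxA.1 hxA.2)
    have hmono : Monotone fun n => {x | 0 < garsiaMax P (f - (a : ℝ) • g) n x} :=
      fun i j hij x hx => lt_of_lt_of_le hx (garsiaMax_monotone P _ hij x)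
    calc (a : ℝ≥0∞) * ∫⁻ x in A, ENNReal.ofReal (g x) ∂m
        ≤ a * ∫⁻ x in ⋃ n, {x | 0 < garsiaMax P (f - (a : ℝ) • g) n x},
            ENNReal.ofReal (g x) ∂m := by
          gcongr a * ?_
          exact lintegral_mono' (Measure.restrict_mono_ae hsub) le_rfl
      _ ≤ ∫⁻ x, ENNReal.ofReal (f x) ∂m := by
          rw [setLIntegral_iUnion_of_directed _ hmono.directed_le, ENNReal.mul_iSup]
          refine iSup_le fun n => ?_
          simpa using hP.mul_setLIntegral_garsiaMax_pos_le hf hf0 hg hg0 a.cast_nonneg n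
  have hfin : ∫⁻ x, ENNReal.ofReal (f x) ∂m < ⊤ := hf.lintegral_lt_top
  have hzero : ∫⁻ x in A, ENNReal.ofReal (g x) ∂m = 0 := by
    by_contra hne
    obtain ⟨a, ha⟩ := ENNReal.exists_nat_mul_gt hne hfin.ne
    exact (hbound a).not_gt ha
  rw [lintegral_eq_zero_iff' hg.aemeasurable.ennreal_ofReal.restrict] at hzero
  filter_upwards [(ae_restrict_iff'₀ hA).1 hzero, hg0] with x hx hgx hf' hg'
  exact le_antisymm (ENNReal.ofReal_eq_zero.1 (hx ⟨hf', hg'⟩)) hgx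

end IsMarkovOperator

/-- For every nonnegative `u ∈ L¹`, a.e. on the conservative part `C` the sum
`∑ₖ (Pᵏ u)(x)` is `0` or `∞`, and a.e. on the dissipative part `D = X \ C` it is finite. -/
theorem sum_iterates_mem_zero_top_on_conservative_and_finite_on_dissipative
    {X : Type*} [MeasurableSpace X] (m : Measure X) [SigmaFinite m]
    (P : (X → ℝ) →ₗ[ℝ] (X → ℝ)) (hP : IsMarkovOperator m P)
    (w : X → ℝ) (hwInt : Integrable w m) (hwPos : ∀ᵐ x ∂m, 0 < w x)
    (u : X → ℝ) (huInt : Integrable u m) (huPos : 0 ≤ᵐ[m] u) :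
    (∀ᵐ x ∂m, x ∈ conservativePart P w →
      (∑' k : ℕ, ENNReal.ofReal ((P ^ k) u x)) = 0 ∨
      (∑' k : ℕ, ENNReal.ofReal ((P ^ k) u x)) = ⊤) ∧
    (∀ᵐ x ∂m, x ∉ conservativePart P w →
      (∑' k : ℕ, ENNReal.ofReal ((P ^ k) u x)) < ⊤) := by
  have hw0 : 0 ≤ᵐ[m] w := hwPos.mono fun x hx => hx.le
  constructor
  · have key := ae_all_iff.2 fun k => hP.ae_eq_zero_of_tsum_pow_lt_top hwInt hw0
      (hP.integrable_pow huInt k) (hP.pow_nonneg huInt huPos k)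
    filter_upwards [key] with x hx hC
    refine or_iff_not_imp_right.2 fun hfin => ENNReal.tsum_eq_zero.2 fun k => ?_
    rw [hx k hC, ENNReal.ofReal_zero]
    refine lt_of_le_of_lt ?_ (lt_top_iff_ne_top.2 hfin)
    simp_rw [← Module.End.mul_apply, ← pow_add]
    exact ENNReal.tsum_comp_le_tsum_of_injective (add_left_injective k)
      fun j => ENNReal.ofReal ((P ^ j) u x)
  · filter_upwards [hP.ae_eq_zero_of_tsum_pow_lt_top huInt huPos hwInt hw0, hwPos]
      with x hx hwx hD
    by_contra hu
    exact hwx.ne' (hx (not_lt_top_iff.1 hu) (lt_top_iff_ne_top.2 hD))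
end

section
/- Let P be a Markov operator on L¹(X,m) and let 𝒜 ⊆ Σ be an admissible family. Suppose there exists a measurable function u : X → [0,∞] with u > 0 a.e. that is locally integrable with respect to 𝒜 and subinvariant, i.e., there is a sequence (fₖ) of nonnegative functions in L¹(X,m) increasing pointwise a.e. to u such that the a.e. pointwise limit P u of P fₖ satisfies P u ≤ u a.e. Then P is smoothing with respect to 𝒜. -/
open MeasureTheory Filter Topology ENNReal

/-- An admissible family `𝒜` of measurable sets: each member is measurable of finite
measure, `𝒜` is closed under pairwise unions, and a countable subfamily covers `X`
up to an `m`-null set. -/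
def AdmissibleFamily {X : Type*} [MeasurableSpace X] (m : Measure X)
    (𝒜 : Set (Set X)) : Prop :=
  (∀ A ∈ 𝒜, MeasurableSet A ∧ m A < ⊤) ∧
  (∀ A ∈ 𝒜, ∀ B ∈ 𝒜, A ∪ B ∈ 𝒜) ∧
  (∃ g : ℕ → Set X, (∀ n, g n ∈ 𝒜) ∧ m (⋃ n, g n)ᶜ = 0)

/-- `P` is smoothing with respect to `𝒜`: for every `A ∈ 𝒜`, `f ∈ L¹` and `ε > 0` there
is `δ > 0` such that every measurable `E ⊆ A` with `m(E) ≤ δ` satisfies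
`∫_E Pⁿ f dm ≤ ε` for all `n ≥ 1`. -/
def Smoothing {X : Type*} [MeasurableSpace X] (m : Measure X)
    (P : (X → ℝ) →ₗ[ℝ] (X → ℝ)) (𝒜 : Set (Set X)) : Prop :=
  ∀ A ∈ 𝒜, ∀ f : X → ℝ, Integrable f m → ∀ ε : ℝ, 0 < ε → ∃ δ : ℝ, 0 < δ ∧
    ∀ E : Set X, MeasurableSet E → E ⊆ A → m E ≤ ENNReal.ofReal δ →
      ∀ n : ℕ, 1 ≤ n → ∫ x in E, (P ^ n) f x ∂m ≤ ε

/-- `u : X → [0,∞]` is subinvariant for `P`: there is a sequence `(fₖ)` of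
nonnegative `L¹` functions increasing pointwise a.e. to `u` such that the a.e. pointwise
limit `Pu` of `P fₖ` (the extension of `P` to `u`) satisfies `Pu ≤ u` a.e. -/
def Subinvariant {X : Type*} [MeasurableSpace X] (m : Measure X)
    (P : (X → ℝ) →ₗ[ℝ] (X → ℝ)) (u : X → ℝ≥0∞) : Prop :=
  ∃ f : ℕ → X → ℝ,
    (∀ k, Integrable (f k) m) ∧ (∀ k, 0 ≤ᵐ[m] f k) ∧
    (∀ᵐ x ∂m, Monotone fun k => f k x) ∧
    (∀ᵐ x ∂m, Filter.Tendsto (fun k => ENNReal.ofReal (f k x)) atTop (𝓝 (u x))) ∧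
    ∃ Pu : X → ℝ≥0∞,
      (∀ᵐ x ∂m, Filter.Tendsto (fun k => ENNReal.ofReal (P (f k) x)) atTop (𝓝 (Pu x))) ∧
      (∀ᵐ x ∂m, Pu x ≤ u x)

namespace IsMarkovOperator

variable {X : Type*} [MeasurableSpace X] {m : Measure X} {P : (X → ℝ) →ₗ[ℝ] (X → ℝ)}

theorem ae_mono (hP : IsMarkovOperator m P) {f g : X → ℝ} (hf : Integrable f m)
    (hg : Integrable g m) (hfg : f ≤ᵐ[m] g) : P f ≤ᵐ[m] P g := by
  have h := hP.2.1 (g - f) (hg.sub hf) (by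
    filter_upwards [hfg] with x hx
    simpa using hx)
  filter_upwards [h] with x hx
  rw [map_sub] at hx
  simpa using hx

theorem pow (hP : IsMarkovOperator m P) (n : ℕ) : IsMarkovOperator m (P ^ n) := by
  induction n with
  | zero => exact ⟨fun f hf => hf, fun f _ hf => hf, fun f _ => le_rfl⟩
  | succ n ih =>
    rw [pow_succ']
    exact ⟨fun f hf => hP.1 _ (ih.1 f hf),
      fun f hf h0 => hP.2.1 _ (ih.1 f hf) (ih.2.1 f hf h0),
      fun f hf => (hP.2.2 _ (ih.1 f hf)).trans (ih.2.2 f hf)⟩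

/-- Convergence in `L¹` of `g k` to `g` gives almost everywhere convergence of `P (g k)` to `P g`
along a subsequence. -/
theorem exists_subseq_tendsto_ae (hP : IsMarkovOperator m P) {g : ℕ → X → ℝ} {g₀ : X → ℝ}
    (hg : ∀ k, Integrable (g k) m) (hg₀ : Integrable g₀ m)
    (hlim : Tendsto (fun k => ∫ x, |g k x - g₀ x| ∂m) atTop (𝓝 0)) :
    ∃ ns : ℕ → ℕ, StrictMono ns ∧
      ∀ᵐ x ∂m, Tendsto (fun i => P (g (ns i)) x) atTop (𝓝 (P g₀ x)) := by
  have hPg : ∀ k, Integrable (P (g k)) m := fun k => hP.1 _ (hg k)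
  have hPlim : Tendsto (fun k => eLpNorm (P (g k) - P g₀) 1 m) atTop (𝓝 0) := by
    have h : Tendsto (fun k => ENNReal.ofReal (∫ x, |g k x - g₀ x| ∂m)) atTop (𝓝 0) := by
      simpa using ENNReal.tendsto_ofReal hlim
    refine tendsto_of_tendsto_of_tendsto_of_le_of_le tendsto_const_nhds h (fun _ => zero_le) ?_
    intro k
    show eLpNorm (P (g k) - P g₀) 1 m ≤ _
    rw [eLpNorm_one_eq_lintegral_enorm,
      ← ofReal_integral_norm_eq_lintegral_enorm ((hPg k).sub (hP.1 _ hg₀)), ← map_sub]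
    exact ENNReal.ofReal_le_ofReal (hP.2.2 _ ((hg k).sub hg₀))
  exact (tendstoInMeasure_of_tendsto_eLpNorm one_ne_zero
    (fun k => (hPg k).aestronglyMeasurable) (hP.1 _ hg₀).aestronglyMeasurable
    hPlim).exists_seq_tendsto_ae

theorem ofReal_le_mul_of_subinvariant (hP : IsMarkovOperator m P) {u : X → ℝ≥0∞}
    (hsub : Subinvariant m P u) (c : ℕ) {g : X → ℝ} (hg : Integrable g m) (hg0 : 0 ≤ᵐ[m] g)
    (hgu : ∀ᵐ x ∂m, ENNReal.ofReal (g x) ≤ c * u x) :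
    ∀ᵐ x ∂m, ENNReal.ofReal (P g x) ≤ c * u x := by
  obtain ⟨f, hf, hf0, -, hfu, Pu, hPu, hPuu⟩ := hsub
  have hcf : ∀ k, Integrable ((c : ℝ) • f k) m := fun k => (hf k).smul _
  have hmin : ∀ k, Integrable (g ⊓ (c : ℝ) • f k) m := fun k => hg.inf (hcf k)
  have hf0' := ae_all_iff.2 hf0
  have hlim : ∀ᵐ x ∂m, Tendsto (fun k => (g ⊓ (c : ℝ) • f k) x) atTop (𝓝 (g x)) := by
    filter_upwards [hg0, hgu, hfu, hf0'] with x hx0 hxu hxf hxf0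
    have h1 : Tendsto (fun k => min (ENNReal.ofReal (g x)) (c * ENNReal.ofReal (f k x))) atTop
        (𝓝 (ENNReal.ofReal (g x))) := by
      have h2 : Tendsto (fun k => c * ENNReal.ofReal (f k x)) atTop (𝓝 (c * u x)) :=
        ENNReal.Tendsto.const_mul hxf (Or.inr (ENNReal.natCast_ne_top c))
      simpa [min_eq_left hxu] using (tendsto_const_nhds (x := ENNReal.ofReal (g x))).min h2
    have h3 := (ENNReal.tendsto_toReal ENNReal.ofReal_ne_top).comp h1
    rw [ENNReal.toReal_ofReal hx0] at h3
    refine h3.congr fun k => ?_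
    have hk : 0 ≤ (c : ℝ) * f k x := mul_nonneg c.cast_nonneg (hxf0 k)
    have hck : (c : ℝ≥0∞) * ENNReal.ofReal (f k x) = ENNReal.ofReal (c * f k x) := by
      rw [ENNReal.ofReal_mul c.cast_nonneg, ENNReal.ofReal_natCast]
    simp only [Function.comp_apply, Pi.inf_apply, Pi.smul_apply, smul_eq_mul]
    rw [hck, ← ENNReal.ofReal_min, ENNReal.toReal_ofReal (le_min hx0 hk)]
  have hL1 : Tendsto (fun k => ∫ x, |(g ⊓ (c : ℝ) • f k) x - g x| ∂m) atTop (𝓝 0) := by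
    have h := tendsto_integral_of_dominated_convergence (μ := m)
      (F := fun k x => |(g ⊓ (c : ℝ) • f k) x - g x|) (f := fun _ => 0) (fun x => |g x|)
      (fun k => ((hmin k).sub hg).abs.aestronglyMeasurable) hg.abs ?_ ?_
    · simpa using h
    · intro k
      filter_upwards [hg0, hf0 k] with x hx0 hxf
      have hk : 0 ≤ (c : ℝ) * f k x := mul_nonneg c.cast_nonneg hxf
      have h1 : min (g x) (c * f k x) ≤ g x := min_le_left _ _
      have h2 : 0 ≤ min (g x) (c * f k x) := le_min hx0 hk
      have h3 : |min (g x) (c * f k x) - g x| ≤ |g x| := by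
        rw [abs_of_nonneg (show 0 ≤ g x from hx0), abs_le]
        constructor <;> linarith
      simpa using h3
    · filter_upwards [hlim] with x hx
      simpa using (hx.sub_const (g x)).abs
  obtain ⟨ns, hns, hae⟩ := hP.exists_subseq_tendsto_ae hmin hg hL1
  have hle := ae_all_iff.2 fun k =>
    hP.ae_mono (hmin k) (hcf k) (Eventually.of_forall fun x => min_le_right _ _)
  filter_upwards [hae, hle, hPu, hPuu] with x hx hxle hxPu hxu
  have h2 : Tendsto (fun i => (c : ℝ≥0∞) * ENNReal.ofReal (P (f (ns i)) x)) atTop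
      (𝓝 (c * Pu x)) :=
    ENNReal.Tendsto.const_mul (hxPu.comp hns.tendsto_atTop) (Or.inr (ENNReal.natCast_ne_top c))
  refine (le_of_tendsto_of_tendsto' (ENNReal.tendsto_ofReal hx) h2 fun i => ?_).trans
    (mul_le_mul_right hxu _)
  rw [← ENNReal.ofReal_natCast, ← ENNReal.ofReal_mul c.cast_nonneg]
  refine ENNReal.ofReal_le_ofReal ((hxle (ns i)).trans_eq ?_)
  simp

theorem pow_ofReal_le_mul_of_subinvariant (hP : IsMarkovOperator m P) {u : X → ℝ≥0∞}
    (hsub : Subinvariant m P u) (c : ℕ) {g : X → ℝ} (hg : Integrable g m) (hg0 : 0 ≤ᵐ[m] g)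
    (hgu : ∀ᵐ x ∂m, ENNReal.ofReal (g x) ≤ c * u x) (n : ℕ) :
    ∀ᵐ x ∂m, ENNReal.ofReal ((P ^ n) g x) ≤ c * u x := by
  induction n with
  | zero => exact hgu
  | succ n ih =>
    rw [pow_succ']
    exact hP.ofReal_le_mul_of_subinvariant hsub c ((hP.pow n).1 g hg) ((hP.pow n).2.1 g hg hg0) ih

end IsMarkovOperator

/-- The positive part of an integrable function is an `L¹`-limit of nonnegative functions, each
dominated by a multiple of the a.e. positive function `u`. -/
theorem exists_truncation_integral_le {X : Type*} [MeasurableSpace X] {m : Measure X}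
    {u : X → ℝ≥0∞} (hu : Measurable u) (huPos : ∀ᵐ x ∂m, 0 < u x) {f : X → ℝ}
    (hf : Integrable f m) {ε : ℝ} (hε : 0 < ε) :
    ∃ (c : ℕ) (g : X → ℝ), Integrable g m ∧ 0 ≤ g ∧ (∀ x, ENNReal.ofReal (g x) ≤ c * u x) ∧
      ∫ x, |max (f x) 0 - g x| ∂m ≤ ε := by
  let g : ℕ → X → ℝ := fun k x => (min (ENNReal.ofReal (f x)) (k * u x)).toReal
  have hg0 : ∀ k x, 0 ≤ g k x := fun k x => ENNReal.toReal_nonneg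
  have hgf : ∀ k x, g k x ≤ max (f x) 0 := fun k x => by
    rw [← ENNReal.toReal_ofReal']
    exact ENNReal.toReal_mono ENNReal.ofReal_ne_top (min_le_left _ _)
  have hgm : ∀ k, AEStronglyMeasurable (g k) m := fun k =>
    ((hf.aemeasurable.ennreal_ofReal.min
      ((hu.const_mul _).aemeasurable)).ennreal_toReal).aestronglyMeasurable
  have hfp : Integrable (fun x => max (f x) 0) m := hf.pos_part
  have hgi : ∀ k, Integrable (g k) m := fun k =>
    hfp.mono' (hgm k) (Eventually.of_forall fun x => by
      rw [Real.norm_of_nonneg (hg0 k x)]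
      exact hgf k x)
  have hL1 : Tendsto (fun k => ∫ x, |max (f x) 0 - g k x| ∂m) atTop (𝓝 0) := by
    have h := tendsto_integral_of_dominated_convergence (μ := m)
      (F := fun k x => |max (f x) 0 - g k x|) (f := fun _ => 0) (fun x => max (f x) 0)
      (fun k => (hfp.sub (hgi k)).abs.aestronglyMeasurable) hfp ?_ ?_
    · simpa using h
    · intro k
      refine Eventually.of_forall fun x => ?_
      rw [Real.norm_eq_abs, abs_abs, abs_of_nonneg (sub_nonneg.2 (hgf k x))]
      linarith [hg0 k x]
    · filter_upwards [huPos] with x hx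
      have h1 : Tendsto (fun k : ℕ => (k : ℝ≥0∞) * u x) atTop (𝓝 ⊤) := by
        have h2 := ENNReal.Tendsto.mul_const (b := u x) ENNReal.tendsto_nat_nhds_top
          (Or.inl ENNReal.top_ne_zero)
        rwa [ENNReal.top_mul hx.ne'] at h2
      have h3 := h1.eventually (lt_mem_nhds (ENNReal.ofReal_lt_top (r := f x)))
      refine tendsto_const_nhds.congr' ?_
      filter_upwards [h3] with k hk
      simp only [g]
      rw [min_eq_left hk.le, ENNReal.toReal_ofReal', sub_self, abs_zero]
  obtain ⟨c, hc⟩ := (hL1.eventually (gt_mem_nhds hε)).exists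
  refine ⟨c, g c, hgi c, hg0 c, fun x => ?_, hc.le⟩
  exact ENNReal.ofReal_toReal_le.trans (min_le_right _ _)

/-- If there exists a measurable, a.e. positive, locally integrable (w.r.t. `𝒜`)
subinvariant function `u`, then `P` is smoothing with respect to `𝒜`. -/
theorem smoothing_of_subinvariant
    {X : Type*} [MeasurableSpace X] (m : Measure X) [SigmaFinite m]
    (P : (X → ℝ) →ₗ[ℝ] (X → ℝ)) (hP : IsMarkovOperator m P)
    (𝒜 : Set (Set X)) (h𝒜 : AdmissibleFamily m 𝒜)
    (u : X → ℝ≥0∞) (hu : Measurable u) (huPos : ∀ᵐ x ∂m, 0 < u x)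
    (huLoc : ∀ A ∈ 𝒜, ∫⁻ x in A, u x ∂m < ⊤)
    (hsub : Subinvariant m P u) :
    Smoothing m P 𝒜 := by
  intro A hA f hf ε hε
  obtain ⟨c, g, hg, hg0, hgu, hfg⟩ := exists_truncation_integral_le hu huPos hf (half_pos hε)
  have hcu : ∫⁻ x in A, c * u x ∂m ≠ ⊤ := by
    rw [lintegral_const_mul _ hu]
    exact ENNReal.mul_ne_top (ENNReal.natCast_ne_top c) (huLoc A hA).ne
  obtain ⟨δ, hδ, hδu⟩ := exists_pos_setLIntegral_lt_of_measure_lt hcu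
    (ENNReal.ofReal_pos.2 (half_pos hε)).ne'
  obtain ⟨r, hr0, hrδ⟩ := ENNReal.lt_iff_exists_nnreal_btwn.1 hδ
  refine ⟨r, by exact_mod_cast hr0, fun E hE hEA hmE n _ => ?_⟩
  rw [ENNReal.ofReal_coe_nnreal] at hmE
  have hEu : ∫⁻ x in E, c * u x ∂m ≤ ENNReal.ofReal (ε / 2) := by
    have h := hδu E ((Measure.restrict_apply_le A E).trans_lt (hmE.trans_lt hrδ))
    rw [Measure.restrict_restrict hE, Set.inter_eq_self_of_subset_left hEA] at h
    exact h.le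
  have hPn := hP.pow n
  have hfp : Integrable (fun x => max (f x) 0) m := hf.pos_part
  have hPg : ∫ x in E, (P ^ n) g x ∂m ≤ ε / 2 := by
    rw [integral_eq_lintegral_of_nonneg_ae
      (ae_restrict_of_ae (hPn.2.1 g hg (Eventually.of_forall hg0)))
      (hPn.1 g hg).aestronglyMeasurable.restrict]
    refine ENNReal.toReal_le_of_le_ofReal (half_pos hε).le (le_trans ?_ hEu)
    exact lintegral_mono_ae (ae_restrict_of_ae (hP.pow_ofReal_le_mul_of_subinvariant hsub c hg
      (Eventually.of_forall hg0) (Eventually.of_forall hgu) n))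
  have hd : Integrable ((fun x => max (f x) 0) - g) m := hfp.sub hg
  have hPd : ∫ x in E, (P ^ n) ((fun x => max (f x) 0) - g) x ∂m ≤ ε / 2 :=
    calc ∫ x in E, (P ^ n) ((fun x => max (f x) 0) - g) x ∂m
        ≤ ∫ x in E, |(P ^ n) ((fun x => max (f x) 0) - g) x| ∂m :=
          integral_mono (hPn.1 _ hd).integrableOn (hPn.1 _ hd).abs.integrableOn
            fun x => le_abs_self _
      _ ≤ ∫ x, |(P ^ n) ((fun x => max (f x) 0) - g) x| ∂m :=
          setIntegral_le_integral (hPn.1 _ hd).abs (Eventually.of_forall fun x => abs_nonneg _)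
      _ ≤ ∫ x, |max (f x) 0 - g x| ∂m := hPn.2.2 _ hd
      _ ≤ ε / 2 := hfg
  calc ∫ x in E, (P ^ n) f x ∂m
      ≤ ∫ x in E, (P ^ n) (fun x => max (f x) 0) x ∂m :=
        integral_mono_ae (hPn.1 f hf).integrableOn (hPn.1 _ hfp).integrableOn
          (ae_restrict_of_ae (hPn.ae_mono hf hfp (Eventually.of_forall fun x => le_max_left _ _)))
    _ = ∫ x in E, (P ^ n) g x ∂m + ∫ x in E, (P ^ n) ((fun x => max (f x) 0) - g) x ∂m := by
        rw [← integral_add (hPn.1 g hg).integrableOn (hPn.1 _ hd).integrableOn]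
        simp
    _ ≤ ε := by linarith
end

section
/- Let P be a Markov operator on L¹(X,m) and let 𝒜 ⊆ Σ be an admissible family. If P is dissipative and P is smoothing with respect to 𝒜, then P is sweeping with respect to 𝒜: lim_{n→∞} ∫_A (Pⁿ f) dm = 0 for every A ∈ 𝒜 and every f ∈ L¹(X,m). -/
open MeasureTheory Filter Topology ENNReal

/-- `P` is dissipative: for every `w ∈ L¹` with `w > 0` a.e., the sum `∑ₖ (Pᵏ w)(x)` is
finite for a.e. `x`. -/
def Dissipative {X : Type*} [MeasurableSpace X] (m : Measure X)
    (P : (X → ℝ) →ₗ[ℝ] (X → ℝ)) : Prop :=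
  ∀ w : X → ℝ, Integrable w m → (∀ᵐ x ∂m, 0 < w x) →
    ∀ᵐ x ∂m, (∑' k : ℕ, ENNReal.ofReal ((P ^ k) w x)) < ⊤

/-- Iterates of a Markov operator preserve integrability. -/
theorem IsMarkovOperator.integrable_pow_s4 {X : Type*} [MeasurableSpace X] {m : Measure X}
    {P : (X → ℝ) →ₗ[ℝ] (X → ℝ)} (hP : IsMarkovOperator m P) {f : X → ℝ}
    (hf : Integrable f m) (n : ℕ) : Integrable ((P ^ n) f) m := by
  induction n with
  | zero => simpa using hf
  | succ k ih =>
    rw [pow_succ', Module.End.mul_apply]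
    exact hP.1 _ ih

/-- Iterates of a Markov operator are positive. -/
theorem IsMarkovOperator.pow_nonneg_s4 {X : Type*} [MeasurableSpace X] {m : Measure X}
    {P : (X → ℝ) →ₗ[ℝ] (X → ℝ)} (hP : IsMarkovOperator m P) {f : X → ℝ}
    (hf : Integrable f m) (h0 : 0 ≤ᵐ[m] f) (n : ℕ) : 0 ≤ᵐ[m] (P ^ n) f := by
  induction n with
  | zero => simpa using h0
  | succ k ih =>
    rw [pow_succ', Module.End.mul_apply]
    exact hP.2.1 _ (hP.integrable_pow_s4 hf k) ih

/-- Iterates of a Markov operator preserve domination. -/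
theorem IsMarkovOperator.abs_pow_le {X : Type*} [MeasurableSpace X] {m : Measure X}
    {P : (X → ℝ) →ₗ[ℝ] (X → ℝ)} (hP : IsMarkovOperator m P) {f w : X → ℝ}
    (hf : Integrable f m) (hw : Integrable w m) (hfw : ∀ᵐ x ∂m, |f x| ≤ w x) (n : ℕ) :
    ∀ᵐ x ∂m, |(P ^ n) f x| ≤ (P ^ n) w x := by
  have h₁ := hP.pow_nonneg_s4 (hw.sub hf)
    (by filter_upwards [hfw] with x hx using sub_nonneg.2 (abs_le.1 hx).2) n
  have h₂ := hP.pow_nonneg_s4 (hw.add hf)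
    (by filter_upwards [hfw] with x hx using by
          simpa [add_comm] using neg_le_iff_add_nonneg'.1 (neg_le.1 (abs_le.1 hx).1)) n
  rw [map_sub] at h₁
  rw [map_add] at h₂
  filter_upwards [h₁, h₂] with x hx₁ hx₂
  simp only [Pi.zero_apply, Pi.sub_apply, Pi.add_apply] at hx₁ hx₂
  exact abs_le.2 ⟨by linarith, by linarith⟩

/-- The orbit of an a.e. positive integrable function under a dissipative Markov operator
tends to zero almost everywhere. -/
theorem Dissipative.ae_tendsto_zero {X : Type*} [MeasurableSpace X] {m : Measure X}
    {P : (X → ℝ) →ₗ[ℝ] (X → ℝ)} (hdis : Dissipative m P) (hP : IsMarkovOperator m P)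
    {w : X → ℝ} (hw : Integrable w m) (hpos : ∀ᵐ x ∂m, 0 < w x) :
    ∀ᵐ x ∂m, Tendsto (fun n : ℕ => (P ^ n) w x) atTop (𝓝 0) := by
  have h0 : ∀ᵐ x ∂m, ∀ n : ℕ, 0 ≤ (P ^ n) w x :=
    ae_all_iff.2 fun n => hP.pow_nonneg_s4 hw (hpos.mono fun x hx => hx.le) n
  filter_upwards [hdis w hw hpos, h0] with x hx hx0
  have h := (ENNReal.tendsto_toReal ENNReal.zero_ne_top).comp
    (ENNReal.tendsto_atTop_zero_of_tsum_ne_top hx.ne)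
  refine h.congr fun n => ?_
  simp [ENNReal.toReal_ofReal (hx0 n)]

/-- If `P` is dissipative and smoothing with respect to an admissible family `𝒜`, then `P`
is sweeping with respect to `𝒜`: `∫_A Pⁿ f dm → 0` for every `A ∈ 𝒜` and `f ∈ L¹`. -/
theorem sweeping_of_dissipative_of_smoothing
    {X : Type*} [MeasurableSpace X] (m : Measure X) [SigmaFinite m]
    (P : (X → ℝ) →ₗ[ℝ] (X → ℝ)) (hP : IsMarkovOperator m P)
    (𝒜 : Set (Set X)) (h𝒜 : AdmissibleFamily m 𝒜)
    (hdis : Dissipative m P) (hsm : Smoothing m P 𝒜) :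
    ∀ A ∈ 𝒜, ∀ f : X → ℝ, Integrable f m →
      Filter.Tendsto (fun n : ℕ => ∫ x in A, (P ^ n) f x ∂m) atTop (𝓝 0) := by
  intro A hA f hf
  obtain ⟨hAm, hAfin⟩ := h𝒜.1 A hA
  obtain ⟨g, hgpos, hgm, hg⟩ := exists_pos_lintegral_lt_of_sigmaFinite m one_ne_zero
  have hgi : Integrable (fun x => (g x : ℝ)) m := by
    refine ⟨hgm.coe_nnreal_real.aestronglyMeasurable, ?_⟩
    simpa [HasFiniteIntegral, enorm] using hg.trans ENNReal.one_lt_top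
  let w : X → ℝ := fun x => |f x| + g x
  have hw : Integrable w m := hf.abs.add hgi
  have hwpos : ∀ x, 0 < w x := fun x =>
    add_pos_of_nonneg_of_pos (abs_nonneg _) (NNReal.coe_pos.2 (hgpos x))
  have hfw : ∀ᵐ x ∂m, |f x| ≤ w x := .of_forall fun x => le_add_of_nonneg_right (g x).2
  have hwn := hP.integrable_pow_s4 hw
  suffices h : Tendsto (fun n : ℕ => ∫ x in A, (P ^ n) w x ∂m) atTop (𝓝 0) by
    refine squeeze_zero_norm (fun n => ?_) h
    exact norm_integral_le_of_norm_le (hwn n).integrableOn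
      (ae_restrict_of_ae (hP.abs_pow_le hf hw hfw n))
  have hlim := hdis.ae_tendsto_zero hP hw (.of_forall hwpos)
  have hnn : ∀ n, 0 ≤ ∫ x in A, (P ^ n) w x ∂m := fun n =>
    setIntegral_nonneg_of_ae (hP.pow_nonneg_s4 hw (.of_forall fun x => (hwpos x).le) n)
  rw [Metric.tendsto_atTop]
  intro ε hε
  obtain ⟨δ, hδ, hsmall⟩ := hsm A hA w hw (ε / 2) (half_pos hε)
  let u : ℕ → X → ℝ := fun n => (hwn n).1.mk _
  have hu : ∀ᵐ x ∂m, ∀ n, (P ^ n) w x = u n x := ae_all_iff.2 fun n => (hwn n).1.ae_eq_mk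
  obtain ⟨t, htA, htm, htδ, hunif⟩ := tendstoUniformlyOn_of_ae_tendsto (f := u) (g := 0)
    (fun n => (hwn n).1.stronglyMeasurable_mk) stronglyMeasurable_zero hAm hAfin.ne
    (by
      filter_upwards [hlim, hu] with x hx hxu _
      exact hx.congr hxu) hδ
  obtain ⟨c, hc, hcA⟩ : ∃ c : ℝ, 0 < c ∧ c * m.real A < ε / 2 :=
    exists_pos_mul_lt (half_pos hε) _ |>.imp fun c hc => ⟨hc.1, mul_comm c _ ▸ hc.2⟩
  obtain ⟨N, hN⟩ := eventually_atTop.1 (Metric.tendstoUniformlyOn_iff.1 hunif c hc)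
  refine ⟨max N 1, fun n hn => ?_⟩
  have hrest : ‖∫ x in A \ t, (P ^ n) w x ∂m‖ ≤ c * m.real (A \ t) := by
    refine norm_setIntegral_le_of_norm_le_const_ae'
      ((measure_mono Set.sdiff_subset).trans_lt hAfin) ?_
    filter_upwards [hu] with x hx hxA
    have h := (hN n (le_of_max_le_left hn) x hxA).le
    rwa [Pi.zero_apply, dist_zero_left, ← hx n] at h
  have hmono : c * m.real (A \ t) ≤ c * m.real A :=
    mul_le_mul_of_nonneg_left (measureReal_mono Set.sdiff_subset hAfin.ne) hc.le
  have hsplit := integral_inter_add_sdiff (μ := m) (s := A) htm (hwn n).integrableOn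
  rw [Set.inter_eq_right.2 htA] at hsplit
  have ht := hsmall t htm htA htδ n (le_of_max_le_right hn)
  rw [Real.dist_0_eq_abs, abs_of_nonneg (hnn n), ← hsplit]
  linarith [(le_abs_self _).trans hrest]
end

section
/- Let M be an invertible N×N real matrix and let φ ∈ ℝ^N with ‖φ‖ = 1. Set S(φ) = Mφ/‖Mφ‖ and define the linear map T : ℝ^N → ℝ^N by T v = ‖Mφ‖⁻¹ (M v − ⟨S(φ), M v⟩ S(φ)) + ⟨φ, v⟩ S(φ). Then |det T| = |det M| / ‖Mφ‖^N. -/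
open RealInnerProductSpace

/-- The full-space completion of the tangent map of the sphere map `φ ↦ Lφ/‖Lφ‖`:
`T v = ‖Lφ‖⁻¹ (L v − ⟨S(φ), L v⟩ S(φ)) + ⟨φ, v⟩ S(φ)` where `S(φ) = Lφ/‖Lφ‖`. -/
noncomputable def fullTangentMap {N : ℕ}
    (L : EuclideanSpace ℝ (Fin N) →ₗ[ℝ] EuclideanSpace ℝ (Fin N))
    (φ : EuclideanSpace ℝ (Fin N)) :
    EuclideanSpace ℝ (Fin N) →ₗ[ℝ] EuclideanSpace ℝ (Fin N) :=
  ‖L φ‖⁻¹ •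
      (L - (((innerSL ℝ (‖L φ‖⁻¹ • L φ)).smulRight (‖L φ‖⁻¹ • L φ)).toLinearMap).comp L) +
    ((innerSL ℝ φ).smulRight (‖L φ‖⁻¹ • L φ)).toLinearMap

theorem fullTangentMap_apply {N : ℕ}
    (L : EuclideanSpace ℝ (Fin N) →ₗ[ℝ] EuclideanSpace ℝ (Fin N))
    (φ v : EuclideanSpace ℝ (Fin N)) :
    fullTangentMap L φ v =
      ‖L φ‖⁻¹ • (L v - ⟪‖L φ‖⁻¹ • L φ, L v⟫ • (‖L φ‖⁻¹ • L φ)) + ⟪φ, v⟫ • (‖L φ‖⁻¹ • L φ) :=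
  rfl

/-- The full tangent map is `‖L φ‖⁻¹ • L` precomposed with a rank-one perturbation of the
identity. -/
theorem fullTangentMap_eq_smul_comp_transvection {N : ℕ}
    (L : EuclideanSpace ℝ (Fin N) →ₗ[ℝ] EuclideanSpace ℝ (Fin N))
    (φ : EuclideanSpace ℝ (Fin N)) :
    fullTangentMap L φ = (‖L φ‖⁻¹ • L) ∘ₗ
      LinearMap.transvection
        (innerₛₗ ℝ φ - ‖L φ‖⁻¹ • (innerₛₗ ℝ (‖L φ‖⁻¹ • L φ)) ∘ₗ L) φ := by
  refine LinearMap.ext fun v => ?_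
  simp only [fullTangentMap_apply, LinearMap.comp_apply, LinearMap.smul_apply,
    LinearMap.transvection.apply, LinearMap.sub_apply, innerₛₗ_apply_apply, map_add, map_smul,
    real_inner_smul_left, smul_eq_mul]
  module

theorem det_fullTangentMap {N : ℕ}
    (L : EuclideanSpace ℝ (Fin N) →ₗ[ℝ] EuclideanSpace ℝ (Fin N))
    (φ : EuclideanSpace ℝ (Fin N)) (hφ : ‖φ‖ = 1) (hL : L φ ≠ 0) :
    LinearMap.det (fullTangentMap L φ) = LinearMap.det L / ‖L φ‖ ^ N := by
  have hn : ‖L φ‖ ≠ 0 := norm_ne_zero_iff.mpr hL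
  have h : 1 + (innerₛₗ ℝ φ - ‖L φ‖⁻¹ • (innerₛₗ ℝ (‖L φ‖⁻¹ • L φ)) ∘ₗ L) φ = 1 := by
    simp only [LinearMap.comp_apply, LinearMap.smul_apply, LinearMap.sub_apply,
      innerₛₗ_apply_apply, real_inner_smul_left, real_inner_self_eq_norm_sq, hφ, smul_eq_mul]
    field_simp
    norm_num
  rw [fullTangentMap_eq_smul_comp_transvection, LinearMap.det_comp, LinearMap.transvection.det, h,
    LinearMap.det_smul, finrank_euclideanSpace_fin, inv_pow, mul_one, div_eq_inv_mul]

/-- For an invertible `N×N` real matrix `M` and a unit vector `φ`, the full-space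
completion `T` of the tangent map of the sphere map `φ ↦ Mφ/‖Mφ‖` satisfies
`|det T| = |det M| / ‖Mφ‖^N`. -/
theorem abs_det_fullTangentMap
    {N : ℕ} (M : Matrix (Fin N) (Fin N) ℝ) (hM : IsUnit M.det)
    (φ : EuclideanSpace ℝ (Fin N)) (hφ : ‖φ‖ = 1) :
    (∀ v, fullTangentMap (Matrix.toEuclideanLin M) φ v =
        ‖Matrix.toEuclideanLin M φ‖⁻¹ •
          (Matrix.toEuclideanLin M v -
            ⟪‖Matrix.toEuclideanLin M φ‖⁻¹ • Matrix.toEuclideanLin M φ,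
              Matrix.toEuclideanLin M v⟫ •
              (‖Matrix.toEuclideanLin M φ‖⁻¹ • Matrix.toEuclideanLin M φ)) +
        ⟪φ, v⟫ • (‖Matrix.toEuclideanLin M φ‖⁻¹ • Matrix.toEuclideanLin M φ)) ∧
    |LinearMap.det (fullTangentMap (Matrix.toEuclideanLin M) φ)| =
      |M.det| / ‖Matrix.toEuclideanLin M φ‖ ^ N := by
  have hdet : LinearMap.det (Matrix.toEuclideanLin M) = M.det := LinearMap.det_toLpLin 2 M
  have hL : Matrix.toEuclideanLin M φ ≠ 0 := by
    intro h
    have hinj := (LinearMap.equivOfDetNeZero _ (hdet ▸ hM.ne_zero)).injective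
    have hφ0 : φ = 0 := hinj (h.trans (map_zero _).symm)
    simp [hφ0] at hφ
  refine ⟨fullTangentMap_apply _ φ, ?_⟩
  rw [det_fullTangentMap _ φ hφ hL, hdet, abs_div, abs_pow, abs_norm]
end

section
/- Let K, N ≥ 1 and for k = 1, …, K let M_k = diag(m_k(1), …, m_k(N)) with m_k(i) ∈ (0,1) and Σ_{k=1}^K m_k(i)² = 1 for every i. Then for every nonzero φ ∈ ℂ^N, Σ_{k=1}^K ‖φ‖²/‖M_k⁻¹φ‖² ≤ 1, where ‖M_k⁻¹φ‖² = Σ_{i=1}^N |φ_i|²/m_k(i)². Moreover, equality holds only if for each k the numbers m_k(s) are equal for all indices s with φ_s ≠ 0. -/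
open Finset

/-- The defect in the weighted harmonic-arithmetic mean inequality, as a weighted variance. -/
lemma sum_mul_sub_sq_div_eq {ι : Type*} [Fintype ι] (w a : ι → ℝ) (ha : ∀ i, 0 < a i)
    (hD : ∑ i, w i / a i ≠ 0) :
    ∑ i, w i * (a i - (∑ j, w j) / ∑ j, w j / a j) ^ 2 / a i =
      ∑ i, w i * a i - (∑ i, w i) * ((∑ i, w i) / ∑ i, w i / a i) := by
  set D := ∑ i, w i / a i with hD_def
  set S := ∑ i, w i with hS_def
  have key : ∀ i, w i * (a i - S / D) ^ 2 / a i =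
      w i * a i - 2 * (S / D) * w i + (S / D) ^ 2 * (w i / a i) := fun i ↦ by
    have := (ha i).ne'
    generalize S / D = c
    field_simp
    ring
  simp only [key, sum_add_distrib, sum_sub_distrib, ← mul_sum, ← hD_def, ← hS_def]
  field_simp
  ring

/-- Let `M_k = diag(m_k(1), …, m_k(N))` with `m_k(i) ∈ (0,1)` and `∑ₖ m_k(i)² = 1` for
every `i`. Then for every nonzero `φ ∈ ℂ^N`, `∑ₖ ‖φ‖²/‖M_k⁻¹φ‖² ≤ 1`, with equality only
if for each `k` the numbers `m_k(s)` agree for all `s` with `φ_s ≠ 0`. -/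
theorem sum_inv_norm_le_one
    {K N : ℕ} (hK : 1 ≤ K) (hN : 1 ≤ N)
    (m : Fin K → Fin N → ℝ)
    (hm : ∀ k i, m k i ∈ Set.Ioo (0 : ℝ) 1)
    (hsum : ∀ i, ∑ k : Fin K, (m k i) ^ 2 = 1)
    (φ : Fin N → ℂ) (hφ : φ ≠ 0) :
    (∑ k : Fin K, (∑ i : Fin N, ‖φ i‖ ^ 2) / (∑ i : Fin N, ‖φ i‖ ^ 2 / (m k i) ^ 2)) ≤ 1 ∧
    ((∑ k : Fin K, (∑ i : Fin N, ‖φ i‖ ^ 2) / (∑ i : Fin N, ‖φ i‖ ^ 2 / (m k i) ^ 2)) = 1 →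
      ∀ k : Fin K, ∀ s t : Fin N, φ s ≠ 0 → φ t ≠ 0 → m k s = m k t) := by
  have hw : ∀ i, 0 ≤ ‖φ i‖ ^ 2 := fun i ↦ by positivity
  have ha : ∀ k i, 0 < m k i ^ 2 := fun k i ↦ pow_pos (hm k i).1 2
  obtain ⟨i₀, hi₀⟩ := Function.ne_iff.mp hφ
  have hw₀ : 0 < ‖φ i₀‖ ^ 2 := pow_pos (norm_pos_iff.mpr hi₀) 2
  have hS : 0 < ∑ i, ‖φ i‖ ^ 2 := sum_pos' (fun i _ ↦ hw i) ⟨i₀, mem_univ _, hw₀⟩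
  have hD : ∀ k, 0 < ∑ i, ‖φ i‖ ^ 2 / m k i ^ 2 := fun k ↦
    sum_pos' (fun i _ ↦ div_nonneg (hw i) (ha k i).le) ⟨i₀, mem_univ _, div_pos hw₀ (ha k i₀)⟩
  have hmean : ∑ k, ∑ i, ‖φ i‖ ^ 2 * m k i ^ 2 = ∑ i, ‖φ i‖ ^ 2 := by
    rw [sum_comm]
    simp only [← mul_sum, hsum, mul_one]
  have hdefect := fun k ↦
    sum_mul_sub_sq_div_eq (fun i ↦ ‖φ i‖ ^ 2) (fun i ↦ m k i ^ 2) (ha k) (hD k).ne'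
  have hterm : ∀ k i, 0 ≤ ‖φ i‖ ^ 2 *
      (m k i ^ 2 - (∑ j, ‖φ j‖ ^ 2) / ∑ j, ‖φ j‖ ^ 2 / m k j ^ 2) ^ 2 / m k i ^ 2 :=
    fun k i ↦ by positivity
  have htotal := sum_congr (rfl : (univ : Finset (Fin K)) = univ) fun k _ ↦ hdefect k
  rw [sum_sub_distrib, hmean, ← mul_sum] at htotal
  constructor
  · have hnonneg := sum_nonneg fun k (_ : k ∈ univ) ↦ sum_nonneg fun i (_ : i ∈ univ) ↦ hterm k i
    rw [htotal] at hnonneg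
    exact le_of_mul_le_mul_left (by linarith) hS
  · intro heq k
    rw [heq, mul_one, sub_self,
      sum_eq_zero_iff_of_nonneg fun k _ ↦ sum_nonneg fun i _ ↦ hterm k i] at htotal
    have hzero := (sum_eq_zero_iff_of_nonneg fun i _ ↦ hterm k i).mp (htotal k (mem_univ k))
    have hconst : ∀ s, φ s ≠ 0 →
        m k s ^ 2 = (∑ j, ‖φ j‖ ^ 2) / ∑ j, ‖φ j‖ ^ 2 / m k j ^ 2 := fun s hs ↦ by
      have hs' := hzero s (mem_univ s)
      rw [div_eq_zero_iff, or_iff_left (ha k s).ne', mul_eq_zero,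
        or_iff_right (pow_ne_zero 2 (norm_ne_zero_iff.mpr hs))] at hs'
      exact sub_eq_zero.mp (pow_eq_zero_iff two_ne_zero |>.mp hs')
    intro s t hs ht
    exact (pow_left_inj₀ (hm k s).1.le (hm k t).1.le two_ne_zero).mp
      ((hconst s hs).trans (hconst t ht).symm)
end

section
/- Let K, N ≥ 1 and for k = 1, …, K let M_k = diag(m_k(1), …, m_k(N)) with m_k(i) ∈ (0,1), Σ_{k=1}^K m_k(i)² = 1 for every i, and m_k(i₁) ≠ m_k(i₂) for every k whenever i₁ ≠ i₂. Then for every φ ∈ ℂ^N with ‖φ‖ = 1 having at least two nonzero components, Σ_{k=1}^K 1/‖M_k⁻¹φ‖² < 1, where ‖M_k⁻¹φ‖² = Σ_{i=1}^N |φ_i|²/m_k(i)². -/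
open Finset

/-- The strict weighted harmonic mean - arithmetic mean inequality. -/
theorem one_div_sum_div_lt_sum_mul {ι : Type*} [Fintype ι] (p a : ι → ℝ)
    (hp : ∀ i, 0 ≤ p i) (hp1 : ∑ i, p i = 1) (ha : ∀ i, 0 < a i)
    (hne : ∃ i j, a i ≠ a j ∧ 0 < p i ∧ 0 < p j) :
    1 / (∑ i, p i / a i) < ∑ i, p i * a i := by
  obtain ⟨i, j, hij, hpi, hpj⟩ := hne
  set A := ∑ i, p i * a i with hA
  have hApos : 0 < A :=
    sum_pos' (fun l _ => mul_nonneg (hp l) (ha l).le) ⟨i, mem_univ i, mul_pos hpi (ha i)⟩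
  have key : ∀ l, p l / a l - p l * (2 / A - a l / A ^ 2) =
      p l * ((a l - A) ^ 2 / (a l * A ^ 2)) := by
    intro l
    have := (ha l).ne'
    field_simp
    ring
  have hnonneg : ∀ l, 0 ≤ (a l - A) ^ 2 / (a l * A ^ 2) := fun l => by
    have := ha l
    positivity
  have hex : ∃ l, 0 < p l ∧ a l ≠ A := by
    by_cases h : a i = A
    · exact ⟨j, hpj, fun h' => hij (h.trans h'.symm)⟩
    · exact ⟨i, hpi, h⟩
  obtain ⟨l, hpl, hl⟩ := hex
  have hlt : ∑ i, p i * (2 / A - a i / A ^ 2) < ∑ i, p i / a i := by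
    refine sum_lt_sum (fun q _ => ?_) ⟨l, mem_univ l, ?_⟩
    · linarith [key q, mul_nonneg (hp q) (hnonneg q)]
    · have h1 := ha l
      have h2 : 0 < (a l - A) ^ 2 := by
        have := sub_ne_zero.mpr hl
        positivity
      have h3 : 0 < p l * ((a l - A) ^ 2 / (a l * A ^ 2)) := by positivity
      linarith [key l]
  have heq : ∑ i, p i * (2 / A - a i / A ^ 2) = 1 / A := by
    simp_rw [mul_sub, ← mul_div_assoc, sum_sub_distrib, ← sum_div, ← sum_mul]
    rw [hp1, ← hA]
    field_simp
    ring
  rw [heq] at hlt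
  exact (one_div_lt hApos ((one_div_pos.mpr hApos).trans hlt)).mp hlt


/-- Let `M_k = diag(m_k(1), …, m_k(N))` with `m_k(i) ∈ (0,1)`, `∑ₖ m_k(i)² = 1` for every
`i`, and `m_k(i₁) ≠ m_k(i₂)` for `i₁ ≠ i₂`. Then for every unit vector `φ ∈ ℂ^N` with at
least two nonzero components, `∑ₖ 1/‖M_k⁻¹φ‖² < 1`. -/
theorem sum_inv_norm_lt_one
    {K N : ℕ} (hK : 1 ≤ K) (hN : 1 ≤ N)
    (m : Fin K → Fin N → ℝ)
    (hm : ∀ k i, m k i ∈ Set.Ioo (0 : ℝ) 1)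
    (hsum : ∀ i, ∑ k : Fin K, (m k i) ^ 2 = 1)
    (hinj : ∀ k : Fin K, ∀ i j : Fin N, i ≠ j → m k i ≠ m k j)
    (φ : Fin N → ℂ) (hφ : ∑ i : Fin N, ‖φ i‖ ^ 2 = 1)
    (htwo : ∃ i j : Fin N, i ≠ j ∧ φ i ≠ 0 ∧ φ j ≠ 0) :
    (∑ k : Fin K, 1 / (∑ i : Fin N, ‖φ i‖ ^ 2 / (m k i) ^ 2)) < 1 := by
  obtain ⟨i, j, hij, hi, hj⟩ := htwo
  have : Nonempty (Fin K) := ⟨⟨0, hK⟩⟩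
  calc ∑ k : Fin K, 1 / (∑ i : Fin N, ‖φ i‖ ^ 2 / (m k i) ^ 2)
      < ∑ k : Fin K, ∑ i : Fin N, ‖φ i‖ ^ 2 * (m k i) ^ 2 := by
        refine sum_lt_sum_of_nonempty univ_nonempty fun k _ => ?_
        refine one_div_sum_div_lt_sum_mul _ _ (fun l => by positivity) hφ
          (fun l => pow_pos (hm k l).1 2) ⟨i, j, fun h => hinj k i j hij ?_, ?_, ?_⟩
        · exact (pow_left_inj₀ (hm k i).1.le (hm k j).1.le two_ne_zero).mp h
        · positivity
        · positivity
    _ = 1 := by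
        rw [sum_comm]
        simp_rw [← mul_sum, hsum, mul_one, hφ]
end

section
/- Let 0 < σ < 1, α > 0, β > 0, and let K(x,y) be the cell-cycle kernel. Then for every x ≥ σ, ∫_σ^∞ K(x,y) y^{β−1} dy = (α / ((α+β)σ^β)) x^{β−1} + (α σ^α (α − σ^β(α+β)) / (β(α+β))) x^{−1−α}. -/
open MeasureTheory Real

/-- The cell-cycle kernel `K(x,y)` with parameters `0 < σ < 1` and `α > 0`:
`K(x,y) = (α/σ)(x/σ)^{−1−α}` for `σ ≤ y < 1`, `K(x,y) = (α/σ)(x/σ)^{−1−α} y^α` for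
`1 ≤ y < x/σ`, and `K(x,y) = 0` otherwise (in particular for `y ≥ x/σ`). -/
noncomputable def cellKernel (σ α x y : ℝ) : ℝ :=
  if σ ≤ y ∧ y < 1 then (α / σ) * (x / σ) ^ (-1 - α)
  else if 1 ≤ y ∧ y < x / σ then (α / σ) * (x / σ) ^ (-1 - α) * y ^ α
  else 0

/-- The function `y ↦ A * y ^ (p - 1)` is integrable on every `[a, b)`. -/
theorem integrableOn_Ico_const_mul_rpow_sub_one (A : ℝ) {p a b : ℝ} (hp : 0 < p) (hab : a ≤ b) :
    IntegrableOn (fun y : ℝ => A * y ^ (p - 1)) (Set.Ico a b) := by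
  rw [integrableOn_Ico_iff_integrableOn_Ioo, ← integrableOn_Ioc_iff_integrableOn_Ioo,
    ← intervalIntegrable_iff_integrableOn_Ioc_of_le hab]
  exact (intervalIntegral.intervalIntegrable_rpow' (by linarith)).const_mul A

/-- The integral of `y ↦ A * y ^ (p - 1)` over `[a, b)`. -/
theorem integral_Ico_const_mul_rpow_sub_one (A : ℝ) {p a b : ℝ} (hp : 0 < p) (hab : a ≤ b) :
    ∫ y in Set.Ico a b, A * y ^ (p - 1) = A * ((b ^ p - a ^ p) / p) := by
  rw [integral_Ico_eq_integral_Ioo, ← integral_Ioc_eq_integral_Ioo,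
    ← intervalIntegral.integral_of_le hab, intervalIntegral.integral_const_mul,
    integral_rpow (Or.inl (by linarith)), sub_add_cancel]

/-- The action of the cell-cycle Frobenius–Perron operator on `y ↦ y^{β−1}`:
`∫_σ^∞ K(x,y) y^{β−1} dy = (α/((α+β)σ^β)) x^{β−1} + (ασ^α(α−σ^β(α+β))/(β(α+β))) x^{−1−α}`
for every `x ≥ σ`. -/
theorem cellKernel_integral_rpow
    (σ α β : ℝ) (hσ : σ ∈ Set.Ioo (0 : ℝ) 1) (hα : 0 < α) (hβ : 0 < β)
    (x : ℝ) (hx : σ ≤ x) :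
    ∫ y in Set.Ici σ, cellKernel σ α x y * y ^ (β - 1) =
      α / ((α + β) * σ ^ β) * x ^ (β - 1) +
        α * σ ^ α * (α - σ ^ β * (α + β)) / (β * (α + β)) * x ^ (-1 - α) := by
  obtain ⟨hσ0, hσ1⟩ := hσ
  have hx0 : 0 < x := hσ0.trans_le hx
  have hxσ : 1 ≤ x / σ := (one_le_div hσ0).2 hx
  have hαβ : 0 < α + β := add_pos hα hβ
  set A : ℝ := α / σ * (x / σ) ^ (-1 - α) with hA
  have hsplit : ∀ y, cellKernel σ α x y * y ^ (β - 1) =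
      (Set.Ico σ 1).indicator (fun y => A * y ^ (β - 1)) y +
        (Set.Ico 1 (x / σ)).indicator (fun y => A * y ^ (α + β - 1)) y := by
    intro y
    by_cases h1 : σ ≤ y ∧ y < 1
    · have h2 : ¬(1 ≤ y ∧ y < x / σ) := fun h => absurd h1.2 h.1.not_gt
      simp [cellKernel, Set.indicator, h1, h2, hA]
    · by_cases h2 : 1 ≤ y ∧ y < x / σ
      · have hy : 0 < y := zero_lt_one.trans_le h2.1
        simp only [cellKernel, Set.indicator, Set.mem_Ico, if_neg h1, if_pos h2, zero_add]
        rw [add_sub_assoc, rpow_add hy, ← mul_assoc]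
      · simp [cellKernel, Set.indicator, h1, h2]
  have hint1 := integrableOn_Ico_const_mul_rpow_sub_one A (p := β) hβ hσ1.le
  have hint2 := integrableOn_Ico_const_mul_rpow_sub_one A (p := α + β) hαβ hxσ
  have hsub1 : Set.Ico σ 1 ⊆ Set.Ici σ := fun y hy => hy.1
  have hsub2 : Set.Ico 1 (x / σ) ⊆ Set.Ici σ := fun y hy => hσ1.le.trans hy.1
  simp_rw [hsplit]
  rw [integral_add (hint1.integrable_indicator measurableSet_Ico).integrableOn
      (hint2.integrable_indicator measurableSet_Ico).integrableOn,
    setIntegral_indicator measurableSet_Ico, setIntegral_indicator measurableSet_Ico,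
    Set.inter_eq_right.2 hsub1, Set.inter_eq_right.2 hsub2,
    integral_Ico_const_mul_rpow_sub_one A hβ hσ1.le,
    integral_Ico_const_mul_rpow_sub_one A hαβ hxσ, one_rpow, one_rpow]
  have hA1 : A = α * σ ^ α * x ^ (-1 - α) := by
    rw [hA, div_rpow hx0.le hσ0.le, rpow_sub hσ0, rpow_neg_one]
    field_simp
  have hA2 : A * (x / σ) ^ (α + β) = α / σ ^ β * x ^ (β - 1) := by
    rw [hA, mul_assoc, ← rpow_add (div_pos hx0 hσ0), show -1 - α + (α + β) = β - 1 by ring,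
      div_rpow hx0.le hσ0.le, rpow_sub_one hσ0.ne']
    field_simp
  calc A * ((1 - σ ^ β) / β) + A * (((x / σ) ^ (α + β) - 1) / (α + β))
      = A * (x / σ) ^ (α + β) / (α + β) + A * ((1 - σ ^ β) / β - 1 / (α + β)) := by ring
    _ = _ := by
      rw [hA2, hA1]
      field_simp
      ring
end

section
/- Let α > 0 and 0 < σ < 1 satisfy α·ln σ > −1, and let K(x,y) be the cell-cycle kernel. Then there exists β > 0 such that for every x ≥ σ, ∫_σ^∞ K(x,y) y^{β−1} dy < x^{β−1}; that is, the function x ↦ x^{β−1} is properly subinvariant for the cell-cycle Frobenius–Perron operator on [σ,∞). -/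
open MeasureTheory Real

/-- The cell-cycle operator applied to `y ↦ y ^ (β - 1)`, in closed form. -/
theorem integral_cellKernel_mul_rpow {α β σ x : ℝ} (hα : 0 < α) (hβ : 0 < β)
    (hσ : σ ∈ Set.Ioo (0 : ℝ) 1) (hx : σ ≤ x) :
    ∫ y in Set.Ici σ, cellKernel σ α x y * y ^ (β - 1) =
      (α / σ) * (x / σ) ^ (-1 - α) *
        ((1 - σ ^ β) / β + ((x / σ) ^ (α + β) - 1) / (α + β)) := by
  obtain ⟨hσ0, hσ1⟩ := hσ
  have hz : 1 ≤ x / σ := (one_le_div hσ0).2 hx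
  set c := (α / σ) * (x / σ) ^ (-1 - α) with hc
  have hker : ∀ y, cellKernel σ α x y * y ^ (β - 1) =
      (Set.Ico σ 1).indicator (fun y => c * y ^ (β - 1)) y +
        (Set.Ico 1 (x / σ)).indicator (fun y => c * y ^ (α + β - 1)) y := by
    intro y
    by_cases h₁ : σ ≤ y ∧ y < 1
    · have h₂ : ¬ (1 ≤ y ∧ y < x / σ) := fun h => h₁.2.not_ge h.1
      simp [cellKernel, Set.indicator, h₁, h₂, hc]
    · by_cases h₂ : 1 ≤ y ∧ y < x / σ
      · have hy : 0 < y := by linarith [h₂.1]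
        have hpow : y ^ (α + β - 1) = y ^ α * y ^ (β - 1) := by
          rw [← rpow_add hy]; ring_nf
        simp only [cellKernel, Set.indicator, Set.mem_Ico, h₁, h₂, if_true, if_false, hpow, hc,
          and_self]
        ring
      · simp [cellKernel, Set.indicator, h₁, h₂]
  have hint : ∀ {a b p : ℝ}, 0 < p → a ≤ b →
      IntegrableOn (fun y : ℝ => c * y ^ (p - 1)) (Set.Ico a b) ∧
      ∫ y in Set.Ico a b, c * y ^ (p - 1) = c * ((b ^ p - a ^ p) / p) := by
    intro a b p hp hab
    have hp' : -1 < p - 1 := by linarith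
    constructor
    · rw [integrableOn_Ico_iff_integrableOn_Ioo, ← integrableOn_Ioc_iff_integrableOn_Ioo]
      exact (intervalIntegrable_iff_integrableOn_Ioc_of_le hab).1
        ((intervalIntegral.intervalIntegrable_rpow' hp').const_mul c)
    · rw [integral_Ico_eq_integral_Ioc, ← intervalIntegral.integral_of_le hab,
        intervalIntegral.integral_const_mul, integral_rpow (Or.inl hp')]
      simp
  obtain ⟨i₁, e₁⟩ := hint (a := σ) (b := 1) hβ hσ1.le
  obtain ⟨i₂, e₂⟩ := hint (a := 1) (b := x / σ) (add_pos hα hβ) hz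
  rw [setIntegral_eq_integral_of_forall_compl_eq_zero]
  · simp_rw [hker]
    rw [integral_add (i₁.integrable_indicator measurableSet_Ico)
      (i₂.integrable_indicator measurableSet_Ico), integral_indicator measurableSet_Ico,
      integral_indicator measurableSet_Ico, e₁, e₂]
    simp only [one_rpow]
    ring
  · intro y hy
    have hy' : y < σ := not_le.1 hy
    have h₁ : ¬ σ ≤ y := hy'.not_ge
    have h₂ : ¬ 1 ≤ y := (hy'.trans hσ1).not_ge
    simp [cellKernel, h₁, h₂]

/-- If `α ln σ > -1`, then `α < σ ^ β (α + β)` for some `β > 0`. -/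
theorem exists_pos_lt_rpow_mul_add {α σ : ℝ} (hα : 0 < α) (hσ : σ ∈ Set.Ioo (0 : ℝ) 1)
    (h : -1 < α * Real.log σ) : ∃ β : ℝ, 0 < β ∧ α < σ ^ β * (α + β) := by
  obtain ⟨hσ0, hσ1⟩ := hσ
  have hL : log σ < 0 := log_neg hσ0 hσ1
  set L := log σ with hLdef
  have hβ : 0 < (1 + α * L) / (-2 * L) := div_pos (by linarith) (by linarith)
  have hβL : (1 + α * L) / (-2 * L) * L = -(1 + α * L) / 2 := by
    have := hL.ne
    field_simp
  generalize (1 + α * L) / (-2 * L) = β at hβ hβL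
  refine ⟨β, hβ, ?_⟩
  have hs : 1 + β * L ≤ σ ^ β := by
    rw [rpow_def_of_pos hσ0, ← hLdef]
    linarith [add_one_le_exp (L * β)]
  calc α < (1 + β * L) * (α + β) := by
        nlinarith [mul_pos hβ (show 0 < 1 + α * L by linarith)]
    _ ≤ σ ^ β * (α + β) := by gcongr

/-- If `α > 0`, `0 < σ < 1` and `α·ln σ > −1`, then there exists `β > 0` such that
`x ↦ x^{β−1}` is properly subinvariant for the cell-cycle Frobenius–Perron operator:
`∫_σ^∞ K(x,y) y^{β−1} dy < x^{β−1}` for every `x ≥ σ`. -/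
theorem cellCycle_properly_subinvariant
    (α σ : ℝ) (hα : 0 < α) (hσ : σ ∈ Set.Ioo (0 : ℝ) 1)
    (h : -1 < α * Real.log σ) :
    ∃ β : ℝ, 0 < β ∧ ∀ x : ℝ, σ ≤ x →
      ∫ y in Set.Ici σ, cellKernel σ α x y * y ^ (β - 1) < x ^ (β - 1) := by
  obtain ⟨β, hβ, hlt⟩ := exists_pos_lt_rpow_mul_add hα hσ h
  refine ⟨β, hβ, fun x hx => ?_⟩
  rw [integral_cellKernel_mul_rpow hα hβ hσ hx]
  obtain ⟨hσ0, hσ1⟩ := hσ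
  have hz : 1 ≤ x / σ := (one_le_div hσ0).2 hx
  have hxz : x = σ * (x / σ) := by field_simp
  generalize x / σ = z at hz hxz
  subst hxz
  have hz0 : 0 < z := by linarith
  have hαβ : 0 < α + β := add_pos hα hβ
  have ht : 1 ≤ z ^ (α + β) := one_le_rpow hz hαβ.le
  have hrhs : (σ * z) ^ (β - 1) = 1 / σ * z ^ (-1 - α) * (σ ^ β * z ^ (α + β)) := by
    have hpow : z ^ (β - 1) = z ^ (-1 - α) * z ^ (α + β) := by
      rw [← rpow_add hz0]; ring_nf
    rw [mul_rpow hσ0.le hz0.le, hpow, rpow_sub_one hσ0.ne']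
    ring
  have hlhs : ∀ w, α / σ * z ^ (-1 - α) * w = 1 / σ * z ^ (-1 - α) * (α * w) := by
    intro w; ring
  rw [hrhs, hlhs]
  refine mul_lt_mul_of_pos_left ?_ (mul_pos (by positivity) (rpow_pos_of_pos hz0 _))
  generalize σ ^ β = s at hlt
  generalize z ^ (α + β) = t at ht
  have hgap : s * t - α * ((1 - s) / β + (t - 1) / (α + β)) =
      (s * (α + β) - α) * ((t - 1) / (α + β) + 1 / β) := by
    field_simp
    ring
  have : 0 < (s * (α + β) - α) * ((t - 1) / (α + β) + 1 / β) :=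
    mul_pos (by linarith)
      (add_pos_of_nonneg_of_pos (div_nonneg (by linarith) hαβ.le) (by positivity))
  linarith
end
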